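/- arXiv:2304.02524 — 10 statements merged into one kernel-verified Lean document; each statement's English description precedes it below -/
import Mathlib

section
/- There exists a constant C : ℕ such that for every r : ℕ, every n, m : ℕ, and every CNF formula φ over n variables with m clauses, there exists a 2-CNF formula φ' over at most C·(n + m·(r+1)) variables such that #φ ≡ #φ' (mod 2^r + 1). -/
/-- A CNF formula over `n` variables: a list of clauses, each a finite set of
literals `(i, b)` where `b = true` means the positive literal `xᵢ` and
`b = false` means the negated literal `¬xᵢ`. -/
abbrev CNF (n : ℕ) := List (Finset (Fin n × Bool))

/-- An assignment satisfies a CNF formula if every clause has a true literal. -/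
def CNF.Sat {n : ℕ} (x : Fin n → Bool) (φ : CNF n) : Prop :=
  ∀ c ∈ φ, ∃ l ∈ c, x l.1 = l.2

/-- The number of satisfying assignments `#φ`. -/
noncomputable def CNF.count {n : ℕ} (φ : CNF n) : ℕ :=
  Nat.card {x : Fin n → Bool // CNF.Sat x φ}

/-- A `k`-CNF: every clause has at most `k` literals. -/
def CNF.IsKCNF {n : ℕ} (k : ℕ) (φ : CNF n) : Prop :=
  ∀ c ∈ φ, c.card ≤ k

/-- A monotone CNF: no negated literals. -/
def CNF.Monotone' {n : ℕ} (φ : CNF n) : Prop :=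
  ∀ c ∈ φ, ∀ l ∈ c, l.2 = true

/-- The primal graph: two distinct variables are adjacent iff they occur
together in some clause. -/
def CNF.primalGraph {n : ℕ} (φ : CNF n) : SimpleGraph (Fin n) :=
  SimpleGraph.fromRel (fun i j => ∃ c ∈ φ, (∃ b, (i, b) ∈ c) ∧ (∃ b, (j, b) ∈ c))

/-- The number of clauses in which variable `i` occurs. -/
def CNF.varDegree {n : ℕ} (φ : CNF n) (i : Fin n) : ℕ :=
  φ.countP (fun c => decide (∃ b, (i, b) ∈ c))

/-- An assignment satisfies an XSAT instance if every clause has exactly one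
true literal. -/
def XSat {n : ℕ} (x : Fin n → Bool) (f : CNF n) : Prop :=
  ∀ c ∈ f, (c.filter (fun l => x l.1 = l.2)).card = 1

/-- The number of satisfying assignments of an XSAT instance. -/
noncomputable def xcount {n : ℕ} (f : CNF n) : ℕ :=
  Nat.card {x : Fin n → Bool // XSat x f}

/-- Total number of literal occurrences. -/
def CNF.size {n : ℕ} (f : CNF n) : ℕ := (f.map Finset.card).sum

/-- The number of perfect matchings of a graph. -/
noncomputable def perfMatch {V : Type*} (G : SimpleGraph V) : ℕ :=
  Nat.card {M : G.Subgraph // M.IsPerfectMatching}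


/-- A finite set of clauses of width at most `k` over an arbitrary finite type of variables
can be realized as a `k`-CNF over `Fin` with the same number of satisfying assignments. -/
theorem CNF.exists_count_eq_of_set {V : Type*} [Fintype V] [DecidableEq V] (k : ℕ)
    (S : Set (Finset (V × Bool))) (hS : ∀ c ∈ S, c.card ≤ k) :
    ∃ φ : CNF (Fintype.card V), CNF.IsKCNF k φ ∧
      CNF.count φ = Nat.card {x : V → Bool // ∀ c ∈ S, ∃ l ∈ c, x l.1 = l.2} := by
  let e := Fintype.equivFin V
  refine ⟨((Set.toFinite S).toFinset.toList).map
    (fun c => c.image (fun l => (e l.1, l.2))), ?_, ?_⟩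
  · intro c hc
    simp only [List.mem_map, Finset.mem_toList, Set.Finite.mem_toFinset] at hc
    obtain ⟨d, hd, rfl⟩ := hc
    exact Finset.card_image_le.trans (hS d hd)
  · refine Nat.card_congr ((e.arrowCongr (Equiv.refl Bool)).symm.subtypeEquiv fun x => ?_)
    simp [CNF.Sat]

/-- Assignments to a block of `r + 1` variables that are forced to vanish if the head variable
is false or if `p` holds: there is one if `p` holds, and `2 ^ r + 1` otherwise. -/
theorem card_block_assignments (r : ℕ) (p : Prop) [Decidable p] :
    Nat.card {v : Fin (r + 1) → Bool // (v 0 = true → ¬ p) ∧ ∀ t, v t = true → v 0 = true} =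
      if p then 1 else 2 ^ r + 1 := by
  classical
  rw [Nat.card_eq_fintype_card, Fintype.card_subtype]
  split_ifs with hp
  · rw [Finset.card_eq_one]
    refine ⟨fun _ => false, ?_⟩
    ext v
    simp only [hp, Finset.mem_filter, Finset.mem_univ, true_and, Finset.mem_singleton]
    constructor
    · rintro ⟨h0, h⟩
      funext t
      by_contra ht
      exact h0 (h t (by simpa using ht)) trivial
    · rintro rfl
      simp
  · have key : (Finset.univ.filter fun v : Fin (r + 1) → Bool =>
        (v 0 = true → ¬ p) ∧ ∀ t, v t = true → v 0 = true) =
        insert (fun _ => false)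
          (Finset.univ.image fun u : Fin r → Bool => (Fin.cons true u : Fin (r + 1) → Bool)) := by
      ext v
      simp only [hp, Finset.mem_filter, Finset.mem_univ, true_and, Finset.mem_insert,
        Finset.mem_image, not_false_eq_true, implies_true]
      constructor
      · intro h
        by_cases h0 : v 0 = true
        · exact Or.inr ⟨Fin.tail v, by rw [← h0]; exact Fin.cons_self_tail v⟩
        · left
          funext t
          by_contra ht
          exact h0 (h t (by simpa using ht))
      · rintro (rfl | ⟨u, rfl⟩) <;> simp
    rw [key, Finset.card_insert_of_notMem, Finset.card_image_of_injective]
    · simp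
    · exact Fin.cons_right_injective (α := fun _ => Bool) true
    · simp only [Finset.mem_image, Finset.mem_univ, true_and, not_exists]
      intro u hu
      simpa using congrFun hu 0

/-- The clauses replacing `φ`: the `j`-th clause gets a block of `r + 1` fresh variables, whose
head excludes every literal of the clause and is implied by every variable of the block. -/
def CNF.blockClauses {n : ℕ} (r : ℕ) (φ : CNF n) :
    Set (Finset ((Fin n ⊕ Fin φ.length × Fin (r + 1)) × Bool)) :=
  {c | (∃ j, ∃ l ∈ φ.get j, c = {(Sum.inl l.1, !l.2), (Sum.inr (j, 0), false)}) ∨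
    ∃ j t, c = {(Sum.inr (j, t), false), (Sum.inr (j, 0), true)}}

theorem CNF.satisfies_blockClauses_iff {n r : ℕ} (φ : CNF n)
    (x : Fin n ⊕ Fin φ.length × Fin (r + 1) → Bool) :
    (∀ c ∈ φ.blockClauses r, ∃ l ∈ c, x l.1 = l.2) ↔
      ∀ j, (x (Sum.inr (j, 0)) = true → ¬ ∃ l ∈ φ.get j, x (Sum.inl l.1) = l.2) ∧
        ∀ t, x (Sum.inr (j, t)) = true → x (Sum.inr (j, 0)) = true := by
  constructor
  · intro h j
    constructor
    · rintro h0 ⟨l, hl, hx⟩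
      obtain ⟨a, ha, hxa⟩ := h _ (Or.inl ⟨j, l, hl, rfl⟩)
      simp only [Finset.mem_insert, Finset.mem_singleton] at ha
      rcases ha with rfl | rfl <;> simp_all
    · intro t ht
      obtain ⟨a, ha, hxa⟩ := h _ (Or.inr ⟨j, t, rfl⟩)
      simp only [Finset.mem_insert, Finset.mem_singleton] at ha
      rcases ha with rfl | rfl <;> simp_all
  · rintro h c (⟨j, l, hl, rfl⟩ | ⟨j, t, rfl⟩)
    · by_cases h0 : x (Sum.inr (j, 0)) = true
      · refine ⟨(Sum.inl l.1, !l.2), by simp, ?_⟩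
        have hne : x (Sum.inl l.1) ≠ l.2 := fun hx => (h j).1 h0 ⟨l, hl, hx⟩
        exact Bool.eq_not.2 hne
      · exact ⟨(Sum.inr (j, 0), false), by simp, by simpa using h0⟩
    · by_cases ht : x (Sum.inr (j, t)) = true
      · exact ⟨(Sum.inr (j, 0), true), by simp, (h j).2 t ht⟩
      · exact ⟨(Sum.inr (j, t), false), by simp, by simpa using ht⟩

open Classical in
theorem CNF.card_satisfying_blockClauses {n : ℕ} (r : ℕ) (φ : CNF n) :
    Nat.card {x : Fin n ⊕ Fin φ.length × Fin (r + 1) → Bool //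
        ∀ c ∈ φ.blockClauses r, ∃ l ∈ c, x l.1 = l.2} =
      ∑ x : Fin n → Bool, ∏ j, if ∃ l ∈ φ.get j, x l.1 = l.2 then 1 else 2 ^ r + 1 := by
  let P (x : Fin n → Bool) (j : Fin φ.length) (v : Fin (r + 1) → Bool) : Prop :=
    (v 0 = true → ¬ ∃ l ∈ φ.get j, x l.1 = l.2) ∧ ∀ t, v t = true → v 0 = true
  have e : {x : Fin n ⊕ Fin φ.length × Fin (r + 1) → Bool //
        ∀ c ∈ φ.blockClauses r, ∃ l ∈ c, x l.1 = l.2} ≃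
      Σ x : Fin n → Bool, ∀ j, {v // P x j v} :=
    { toFun := fun x => ⟨fun i => x.1 (Sum.inl i), fun j => ⟨fun t => x.1 (Sum.inr (j, t)),
        (φ.satisfies_blockClauses_iff x.1).1 x.2 j⟩⟩
      invFun := fun y => ⟨Sum.elim y.1 fun a => (y.2 a.1).1 a.2,
        (φ.satisfies_blockClauses_iff _).2 fun j => (y.2 j).2⟩
      left_inv := by
        rintro ⟨x, hx⟩
        ext (i | a) <;> rfl
      right_inv := fun _ => rfl }
  rw [Nat.card_congr e, Nat.card_sigma]
  refine Finset.sum_congr rfl fun x _ => ?_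
  rw [Nat.card_pi]
  exact Finset.prod_congr rfl fun j _ => card_block_assignments r _

open Classical in
theorem CNF.count_modEq_sum_prod {n : ℕ} (r : ℕ) (φ : CNF n) :
    φ.count ≡ ∑ x : Fin n → Bool, ∏ j, (if ∃ l ∈ φ.get j, x l.1 = l.2 then 1 else 2 ^ r + 1)
      [MOD 2 ^ r + 1] := by
  rw [CNF.count, Nat.card_eq_fintype_card, Fintype.card_subtype, Finset.card_filter]
  refine Nat.ModEq.sum fun x _ => ?_
  split_ifs with h
  · rw [Finset.prod_eq_one fun j _ => if_pos (h _ (List.get_mem φ j))]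
  · simp only [CNF.Sat, not_forall] at h
    obtain ⟨c, hc, hx⟩ := h
    obtain ⟨j, rfl⟩ := List.get_of_mem hc
    refine ((Nat.modEq_zero_iff_dvd).2 ?_).symm
    refine dvd_trans ?_ (Finset.dvd_prod_of_mem _ (Finset.mem_univ j))
    rw [if_neg hx]

/-- reduction #SAT → #2SAT modulo 2^r + 1 (Lemma `satto2sat2kp1`). -/
theorem sat_to_twoSat_mod_two_pow_add_one :
    ∃ C : ℕ, ∀ (r n m : ℕ) (φ : CNF n), φ.length = m →
      ∃ (n' : ℕ) (φ' : CNF n'), n' ≤ C * (n + m * (r + 1)) ∧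
        CNF.IsKCNF 2 φ' ∧ CNF.count φ ≡ CNF.count φ' [MOD 2 ^ r + 1] := by
  refine ⟨1, ?_⟩
  rintro r n m φ rfl
  obtain ⟨φ', hk, hcount⟩ := CNF.exists_count_eq_of_set 2 (φ.blockClauses r) (by
    rintro c (⟨j, l, -, rfl⟩ | ⟨j, t, rfl⟩) <;> exact Finset.card_le_two)
  refine ⟨_, φ', by simp, hk, ?_⟩
  rw [hcount, CNF.card_satisfying_blockClauses]
  exact φ.count_modEq_sum_prod r
end

section
/- There exists a constant C : ℕ such that for every integer M > 2, every n, m : ℕ, and every CNF formula φ over n variables with m clauses, there exists a 2-CNF formula φ' over at most C·(n + m·M) variables such that #φ ≡ #φ' (mod M). -/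
namespace CNF

/-- A clause over `n` variables, regarded as a clause over `n + k` variables. -/
def liftClause {n : ℕ} (k : ℕ) (c : Finset (Fin n × Bool)) : Finset (Fin (n + k) × Bool) :=
  c.image fun l => (Fin.castAdd k l.1, l.2)

/-- A 2-CNF on `n + k` variables: at most one of the last `k` variables is true, and if one of
them is true, then all literals of `c` are false. -/
noncomputable def gadget {n : ℕ} (k : ℕ) (c : Finset (Fin n × Bool)) : CNF (n + k) :=
  ((Finset.univ : Finset (Fin k × Fin k)).filter fun p => p.1 ≠ p.2).toList.map
      (fun p => {(Fin.natAdd n p.1, false), (Fin.natAdd n p.2, false)}) ++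
    ((Finset.univ : Finset (Fin k)) ×ˢ c).toList.map
      (fun p => {(Fin.natAdd n p.1, false), (Fin.castAdd k p.2.1, !p.2.2)})

theorem isKCNF_gadget {n : ℕ} (k : ℕ) (c : Finset (Fin n × Bool)) :
    IsKCNF 2 (gadget k c) := by
  intro d hd
  simp only [gadget, List.mem_append, List.mem_map] at hd
  rcases hd with ⟨p, -, rfl⟩ | ⟨p, -, rfl⟩ <;> exact Finset.card_le_two

theorem sat_append_gadget {n k : ℕ} (c : Finset (Fin n × Bool)) (x : Fin n → Bool)
    (y : Fin k → Bool) :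
    Sat (Fin.append x y) (gadget k c) ↔
      (∀ i j, i ≠ j → y i = false ∨ y j = false) ∧
        ∀ i, ∀ l ∈ c, y i = false ∨ x l.1 ≠ l.2 := by
  simp only [Sat, gadget, List.forall_mem_append, List.forall_mem_map, Finset.mem_toList,
    Finset.exists_mem_insert, Finset.mem_singleton, exists_eq_left, Fin.append_left,
    Fin.append_right, Finset.mem_filter, Finset.mem_product, Finset.mem_univ, true_and,
    Prod.forall, ne_eq, Bool.eq_not]

theorem sat_append_lift {n k : ℕ} (φ : CNF n) (x : Fin n → Bool) (y : Fin k → Bool) :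
    Sat (Fin.append x y) (φ.map (liftClause k)) ↔ Sat x φ := by
  simp [Sat, liftClause]

theorem sat_list_append {n : ℕ} (x : Fin n → Bool) (φ ψ : CNF n) :
    Sat x (φ ++ ψ) ↔ Sat x φ ∧ Sat x ψ := by
  simp [Sat, or_imp, forall_and]

theorem card_at_most_one_true (k : ℕ) :
    Nat.card {y : Fin k → Bool // ∀ i j, i ≠ j → y i = false ∨ y j = false} = k + 1 := by
  let f : Option (Fin k) → {y : Fin k → Bool // ∀ i j, i ≠ j → y i = false ∨ y j = false} :=
    fun o => ⟨fun i => decide (o = some i), by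
      intro i j hij
      by_cases h : o = some i
      · right; simp [h, hij]
      · left; simp [h]⟩
  have hf : Function.Bijective f := by
    constructor
    · intro a b h
      have h' : ∀ i, (a = some i ↔ b = some i) := fun i => by
        simpa [f] using congrFun (congrArg Subtype.val h) i
      exact Option.ext h'
    · rintro ⟨y, hy⟩
      by_cases h : ∃ i, y i = true
      · obtain ⟨i, hi⟩ := h
        refine ⟨some i, Subtype.ext (funext fun j => ?_)⟩
        by_cases hij : i = j
        · subst hij; simp [f, hi]
        · have := hy i j hij
          simp_all [f]
      · refine ⟨none, Subtype.ext (funext fun j => ?_)⟩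
        simp_all [f]
  rw [← Nat.card_eq_of_bijective f hf]
  simp

open Classical in
theorem card_gadget_extensions {n k : ℕ} (c : Finset (Fin n × Bool)) (x : Fin n → Bool) :
    Nat.card {y : Fin k → Bool // Sat (Fin.append x y) (gadget k c)} =
      if ∃ l ∈ c, x l.1 = l.2 then 1 else k + 1 := by
  simp only [sat_append_gadget]
  split_ifs with h
  · obtain ⟨l, hl, hx⟩ := h
    rw [Nat.card_eq_one_iff_unique]
    refine ⟨⟨?_⟩, ⟨⟨fun _ => false, by simp⟩⟩⟩
    rintro ⟨y, -, hy⟩ ⟨z, -, hz⟩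
    refine Subtype.ext (funext fun i => ?_)
    have h₁ := hy i l hl
    have h₂ := hz i l hl
    simp_all
  · rw [← card_at_most_one_true k]
    push Not at h
    refine Nat.card_congr (Equiv.subtypeEquivRight fun y => ?_)
    exact and_iff_left fun i l hl => Or.inr (h l hl)

theorem count_lift_append {n k : ℕ} (φ : CNF n) (ψ : CNF (n + k)) :
    count (φ.map (liftClause k) ++ ψ) =
      Nat.card (Σ x : {x : Fin n → Bool // Sat x φ},
        {y : Fin k → Bool // Sat (Fin.append x.1 y) ψ}) := by
  refine (Nat.card_eq_of_bijective
    (fun p => ⟨Fin.append p.1.1 p.2.1,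
      (sat_list_append _ _ _).2 ⟨(sat_append_lift _ _ _).2 p.1.2, p.2.2⟩⟩) ⟨?_, ?_⟩).symm
  · rintro ⟨⟨x, hx⟩, ⟨y, hy⟩⟩ ⟨⟨x', hx'⟩, ⟨y', hy'⟩⟩ h
    have h' : (Fin.appendEquiv n k) (x, y) = (Fin.appendEquiv n k) (x', y') :=
      congrArg Subtype.val h
    obtain ⟨rfl, rfl⟩ := Prod.mk.inj ((Fin.appendEquiv n k).injective h')
    rfl
  · rintro ⟨z, hz⟩
    obtain ⟨⟨x, y⟩, rfl⟩ := (Fin.appendEquiv n k).surjective z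
    obtain ⟨h₁, h₂⟩ := (sat_list_append _ _ _).1 hz
    exact ⟨⟨⟨x, (sat_append_lift _ _ _).1 h₁⟩, ⟨y, h₂⟩⟩, rfl⟩

theorem count_cons_modEq {n k : ℕ} (c : Finset (Fin n × Bool)) (φ : CNF n) :
    count (c :: φ) ≡ count (φ.map (liftClause k) ++ gadget k c) [MOD k + 1] := by
  classical
  have h : count (c :: φ) =
      ∑ x : {x : Fin n → Bool // Sat x φ}, if ∃ l ∈ c, x.1 l.1 = l.2 then 1 else 0 := by
    rw [← Finset.card_filter, ← Fintype.card_subtype, ← Nat.card_eq_fintype_card]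
    refine (Nat.card_congr ((Equiv.subtypeSubtypeEquivSubtypeInter _
      (fun x : Fin n → Bool => ∃ l ∈ c, x l.1 = l.2)).trans
        (Equiv.subtypeEquivRight fun x => ?_))).symm
    simp [Sat, and_comm]
  rw [h, count_lift_append, Nat.card_sigma]
  simp only [card_gadget_extensions]
  rw [← ZMod.natCast_eq_natCast_iff]
  push_cast
  refine Finset.sum_congr rfl fun x _ => ?_
  split_ifs
  · rfl
  · exact_mod_cast (ZMod.natCast_self (k + 1)).symm

theorem exists_twoCNF_modEq (k : ℕ) {n : ℕ} (φ ψ : CNF n) (hψ : IsKCNF 2 ψ) :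
    ∃ (n' : ℕ) (φ' : CNF n'), n' = n + φ.length * k ∧ IsKCNF 2 φ' ∧
      count (φ ++ ψ) ≡ count φ' [MOD k + 1] := by
  induction hm : φ.length generalizing n with
  | zero =>
    obtain rfl := List.length_eq_zero_iff.1 hm
    exact ⟨n, ψ, by simp, hψ, Nat.ModEq.refl _⟩
  | succ m ih =>
    obtain ⟨c, φ, rfl⟩ := List.exists_cons_of_length_eq_add_one hm
    have hψ' : IsKCNF 2 (ψ.map (liftClause k) ++ gadget k c) := by
      intro d hd
      rcases List.mem_append.1 hd with hd | hd
      · obtain ⟨e, he, rfl⟩ := List.mem_map.1 hd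
        exact Finset.card_image_le.trans (hψ e he)
      · exact isKCNF_gadget k c d hd
    obtain ⟨n', φ', hn', hφ', hc⟩ := ih (φ.map (liftClause k)) _ hψ' (by simpa using hm)
    refine ⟨n', φ', by rw [hn']; ring, hφ', Nat.ModEq.trans ?_ hc⟩
    simpa using count_cons_modEq (k := k) c (φ ++ ψ)

end CNF

/-- reduction #SAT → #2SAT modulo any fixed M > 2 (Lemma `satto2satfixk`). -/
theorem sat_to_twoSat_mod_fixed :
    ∃ C : ℕ, ∀ (M : ℕ), 2 < M → ∀ (n m : ℕ) (φ : CNF n), φ.length = m →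
      ∃ (n' : ℕ) (φ' : CNF n'), n' ≤ C * (n + m * M) ∧
        CNF.IsKCNF 2 φ' ∧ CNF.count φ ≡ CNF.count φ' [MOD M] := by
  refine ⟨1, fun M hM n m φ hm => ?_⟩
  obtain ⟨k, rfl⟩ : ∃ k, M = k + 1 := ⟨M - 1, by omega⟩
  obtain ⟨n', φ', hn', hφ', hc⟩ := CNF.exists_twoCNF_modEq k φ [] (by simp [CNF.IsKCNF])
  refine ⟨n', φ', ?_, hφ', by simpa using hc⟩
  rw [hn', hm, one_mul]
  gcongr
  omega
end

section
/- There exists a constant C : ℕ such that for every n, m : ℕ and every CNF formula φ over n variables with m clauses, there exists a 2-CNF formula φ' over at most C·(n + m·(n+1)) variables such that #φ = #φ' mod (2^n + 1) (i.e., #φ equals the remainder of #φ' upon division by 2^n + 1, since #φ ≤ 2^n). -/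
namespace CNF

/-- The assignments of a switch (index `none`) together with `n` dependent variables: the switch
may be on only if `P` holds, and the dependent variables may be on only if the switch is. -/
abbrev Gadget (n : ℕ) (P : Prop) : Type :=
  {w : Option (Fin n) → Bool //
    (w none = true → P) ∧ ∀ j, w (some j) = true → w none = true}

theorem card_gadget_of_not {n : ℕ} {P : Prop} (hP : ¬ P) : Nat.card (Gadget n P) = 1 := by
  rw [Nat.card_eq_one_iff_unique]
  refine ⟨⟨fun a b => ?_⟩, ⟨⟨fun _ => false, by simp⟩⟩⟩
  have key : ∀ (w : Gadget n P) (o : Option (Fin n)), w.1 o = false := by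
    rintro ⟨w, h₁, h₂⟩ o
    have h₀ : w none = false := by simpa using fun h => hP (h₁ h)
    cases o with
    | none => exact h₀
    | some j => simpa [h₀] using h₂ j
  exact Subtype.ext (funext fun o => (key a o).trans (key b o).symm)

theorem card_gadget_of {n : ℕ} {P : Prop} (hP : P) : Nat.card (Gadget n P) = 2 ^ n + 1 := by
  let e : Option (Fin n → Bool) → Gadget n P := fun v =>
    match v with
    | none => ⟨fun _ => false, by simp⟩
    | some f => ⟨fun o => o.elim true f, by simp [hP]⟩
  have he : Function.Bijective e := by
    constructor
    · intro a b hab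
      have h : ∀ o, (e a).1 o = (e b).1 o := fun o => by rw [hab]
      cases a with
      | none =>
        cases b with
        | none => rfl
        | some g => simpa [e] using h none
      | some f =>
        cases b with
        | none => simpa [e] using h none
        | some g => exact congrArg some (funext fun j => h (some j))
    · rintro ⟨w, h₁, h₂⟩
      rcases Bool.eq_false_or_eq_true (w none) with h₀ | h₀
      · refine ⟨some fun j => w (some j), Subtype.ext (funext fun o => ?_)⟩
        cases o with
        | none => exact h₀.symm
        | some j => rfl
      · refine ⟨none, Subtype.ext (funext fun o => ?_)⟩
        cases o with
        | none => exact h₀.symm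
        | some j => exact Eq.symm (by simpa [h₀] using h₂ j)
  rw [← Nat.card_eq_of_bijective e he]
  simp [Nat.card_eq_fintype_card]

/-- A clause is violated by `x` if all its literals are false. -/
abbrev Violates {n : ℕ} (x : Fin n → Bool) (c : Finset (Fin n × Bool)) : Prop :=
  ∀ l ∈ c, x l.1 ≠ l.2

/-- The original variables of `φ`, together with a gadget for each clause. -/
abbrev GadgetVar {n : ℕ} (φ : CNF n) : Type :=
  Fin n ⊕ Fin φ.length × Option (Fin n)

/-- The 2-CNF in which every clause of `φ` is replaced by a gadget whose switch can be on only if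
the clause is violated. -/
noncomputable def gadgetCNF {n N : ℕ} (φ : CNF n) (e : GadgetVar φ ≃ Fin N) : CNF N :=
  (Finset.univ.biUnion fun i : Fin φ.length =>
    ((φ.get i).image fun l => {(e (.inr (i, none)), false), (e (.inl l.1), !l.2)}) ∪
    (Finset.univ.image fun j : Fin n =>
      {(e (.inr (i, some j)), false), (e (.inr (i, none)), true)})).toList

theorem isKCNF_gadgetCNF {n N : ℕ} (φ : CNF n) (e : GadgetVar φ ≃ Fin N) :
    IsKCNF 2 (gadgetCNF φ e) := by
  intro c hc
  simp only [gadgetCNF, Finset.mem_toList, Finset.mem_biUnion, Finset.mem_union,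
    Finset.mem_image] at hc
  obtain ⟨i, -, ⟨l, -, rfl⟩ | ⟨j, -, rfl⟩⟩ := hc <;> exact Finset.card_le_two

theorem sat_gadgetCNF {n N : ℕ} (φ : CNF n) (e : GadgetVar φ ≃ Fin N) (y : Fin N → Bool) :
    Sat y (gadgetCNF φ e) ↔ ∀ i : Fin φ.length,
      (y (e (.inr (i, none))) = true → Violates (fun k => y (e (.inl k))) (φ.get i)) ∧
      ∀ j, y (e (.inr (i, some j))) = true → y (e (.inr (i, none))) = true := by
  have hbool : ∀ a b : Bool, a = !b ↔ a ≠ b := by decide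
  have himp : ∀ (a : Bool) (p : Prop), (a = false ∨ p) ↔ (a = true → p) := by
    intro a p; cases a <;> simp
  constructor
  · intro h i
    refine ⟨fun hy l hl => ?_, fun j => ?_⟩
    · have := h {(e (.inr (i, none)), false), (e (.inl l.1), !l.2)} (by
        simp only [gadgetCNF, Finset.mem_toList, Finset.mem_biUnion, Finset.mem_union,
          Finset.mem_image]
        exact ⟨i, Finset.mem_univ _, .inl ⟨l, hl, rfl⟩⟩)
      simp only [Finset.mem_insert, Finset.mem_singleton, exists_eq_or_imp, exists_eq_left,
        himp, hbool] at this
      exact this hy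
    · have := h {(e (.inr (i, some j)), false), (e (.inr (i, none)), true)} (by
        simp only [gadgetCNF, Finset.mem_toList, Finset.mem_biUnion, Finset.mem_union,
          Finset.mem_image]
        exact ⟨i, Finset.mem_univ _, .inr ⟨j, Finset.mem_univ _, rfl⟩⟩)
      simpa only [Finset.mem_insert, Finset.mem_singleton, exists_eq_or_imp, exists_eq_left,
        himp] using this
  · intro h c hc
    simp only [gadgetCNF, Finset.mem_toList, Finset.mem_biUnion, Finset.mem_union,
      Finset.mem_image] at hc
    obtain ⟨i, -, ⟨l, hl, rfl⟩ | ⟨j, -, rfl⟩⟩ := hc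
    · simp only [Finset.mem_insert, Finset.mem_singleton, exists_eq_or_imp, exists_eq_left,
        himp, hbool]
      exact fun hy => (h i).1 hy l hl
    · simp only [Finset.mem_insert, Finset.mem_singleton, exists_eq_or_imp, exists_eq_left, himp]
      exact (h i).2 j

theorem sigma_gadget_ext {n : ℕ} {φ : CNF n}
    {s t : Σ x : Fin n → Bool, ∀ i : Fin φ.length, Gadget n (Violates x (φ.get i))}
    (h₁ : s.1 = t.1) (h₂ : ∀ i o, (s.2 i).1 o = (t.2 i).1 o) : s = t := by
  obtain ⟨x, v⟩ := s
  obtain ⟨x', w⟩ := t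
  obtain rfl : x = x' := h₁
  exact congrArg (Sigma.mk x) (funext fun i => Subtype.ext (funext (h₂ i)))

/-- A satisfying assignment of `gadgetCNF φ e` is an assignment of the variables of `φ` together
with an assignment of each gadget. -/
def satGadgetCNFEquiv {n N : ℕ} (φ : CNF n) (e : GadgetVar φ ≃ Fin N) :
    {y : Fin N → Bool // Sat y (gadgetCNF φ e)} ≃
      Σ x : Fin n → Bool, ∀ i : Fin φ.length, Gadget n (Violates x (φ.get i)) where
  toFun y := ⟨fun k => y.1 (e (.inl k)), fun i =>
    ⟨fun o => y.1 (e (.inr (i, o))), (sat_gadgetCNF φ e y.1).1 y.2 i⟩⟩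
  invFun s := ⟨fun v => Sum.elim s.1 (fun p => (s.2 p.1).1 p.2) (e.symm v), by
    rw [sat_gadgetCNF]
    simpa using fun i => (s.2 i).2⟩
  left_inv y := by
    refine Subtype.ext (funext fun v => ?_)
    obtain ⟨u, rfl⟩ := e.surjective v
    rcases u with k | p <;> simp
  right_inv s := by
    exact sigma_gadget_ext (by simp) fun i o => by simp

theorem count_gadgetCNF {n N : ℕ} (φ : CNF n) (e : GadgetVar φ ≃ Fin N) :
    count (gadgetCNF φ e) =
      ∑ x : Fin n → Bool, ∏ i : Fin φ.length, Nat.card (Gadget n (Violates x (φ.get i))) := by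
  rw [count, Nat.card_congr (satGadgetCNFEquiv φ e), Nat.card_sigma]
  simp_rw [Nat.card_pi]

open Classical in
theorem count_eq_sum {n : ℕ} (φ : CNF n) :
    count φ = ∑ x : Fin n → Bool, if Sat x φ then 1 else 0 := by
  rw [count, Nat.card_eq_fintype_card, Fintype.card_subtype, Finset.card_filter]

theorem count_le {n : ℕ} (φ : CNF n) : count φ ≤ 2 ^ n := by
  refine (Nat.card_le_card_of_injective _ Subtype.val_injective).trans ?_
  simp [Nat.card_eq_fintype_card]

theorem count_gadgetCNF_modEq {n N : ℕ} (φ : CNF n) (e : GadgetVar φ ≃ Fin N) :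
    count (gadgetCNF φ e) ≡ count φ [MOD 2 ^ n + 1] := by
  classical
  rw [count_gadgetCNF, count_eq_sum]
  refine Nat.ModEq.sum fun x _ => ?_
  by_cases hx : Sat x φ
  · rw [if_pos hx, Finset.prod_eq_one]
    intro i _
    refine card_gadget_of_not fun h => ?_
    obtain ⟨l, hl, hxl⟩ := hx _ (φ.get_mem i)
    exact h l hl hxl
  · rw [if_neg hx, Nat.modEq_zero_iff_dvd]
    simp only [Sat, not_forall] at hx
    obtain ⟨c, hc, hxc⟩ := hx
    obtain ⟨i, rfl⟩ := List.get_of_mem hc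
    have h : Violates x (φ.get i) := fun l hl hxl => hxc ⟨l, hl, hxl⟩
    rw [← card_gadget_of h]
    exact Finset.dvd_prod_of_mem (fun i => Nat.card (Gadget n (Violates x (φ.get i))))
      (Finset.mem_univ i)

end CNF

/-- counting reduction #SAT → #2SAT (Theorem `satto2sat`). -/
theorem sat_to_twoSat :
    ∃ C : ℕ, ∀ (n m : ℕ) (φ : CNF n), φ.length = m →
      ∃ (n' : ℕ) (φ' : CNF n'), n' ≤ C * (n + m * (n + 1)) ∧
        CNF.IsKCNF 2 φ' ∧ CNF.count φ = CNF.count φ' % (2 ^ n + 1) := by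
  refine ⟨1, fun n m φ hm => ?_⟩
  subst hm
  let e : CNF.GadgetVar φ ≃ Fin (n + φ.length * (n + 1)) :=
    Fintype.equivFinOfCardEq (by simp)
  refine ⟨_, CNF.gadgetCNF φ e, (one_mul _).ge, CNF.isKCNF_gadgetCNF φ e, ?_⟩
  rw [CNF.count_gadgetCNF_modEq φ e, Nat.mod_eq_of_lt (Nat.lt_succ_of_le (CNF.count_le φ))]
end

section
/- There exists a constant C : ℕ such that for every n, m : ℕ and every CNF formula φ over n variables with m clauses, there exists a 2-CNF formula φ' over at most C·(n + m·(n+1)) variables whose primal graph is bipartite and such that #φ = #φ' mod (2^n + 1) (the remainder of #φ' upon division by 2^n + 1). -/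
/-- A variable `none` which, when false, forces the variables `some j` to be false, and which may
only be true if `P` holds, contributes the factor `2 ^ |α| + 1` if `P` holds and `1` otherwise. -/
theorem card_controlled_block {α : Type*} [Fintype α] (P : Prop) [Decidable P] :
    Nat.card {q : Option α → Bool //
      (∀ j, q none = true ∨ q (some j) = false) ∧ (q none = true → P)} =
      if P then 2 ^ Fintype.card α + 1 else 1 := by
  split_ifs with hP
  · let f : Option (α → Bool) → {q : Option α → Bool //
        (∀ j, q none = true ∨ q (some j) = false) ∧ (q none = true → P)} := fun o =>
      match o with
      | none => ⟨fun _ => false, by simp⟩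
      | some z => ⟨fun a => a.elim true z, by simp [hP]⟩
    have hf : Function.Bijective f := by
      constructor
      · rintro (_ | z) (_ | w) h
        · rfl
        · simpa [f] using congrFun (Subtype.ext_iff.mp h) none
        · simpa [f] using congrFun (Subtype.ext_iff.mp h) none
        · congr 1
          funext j
          exact congrFun (Subtype.ext_iff.mp h) (some j)
      · rintro ⟨q, hq, -⟩
        rcases Bool.eq_false_or_eq_true (q none) with h | h
        rotate_left
        · refine ⟨none, Subtype.ext (funext fun a => ?_)⟩
          cases a with
          | none => exact h.symm
          | some j => exact ((hq j).resolve_left (by simp [h])).symm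
        · refine ⟨some fun j => q (some j), Subtype.ext (funext fun a => ?_)⟩
          cases a with
          | none => exact h.symm
          | some j => rfl
    classical
    rw [← Nat.card_congr (Equiv.ofBijective f hf), Nat.card_eq_fintype_card]
    simp
  · refine Nat.card_eq_one_iff_exists.mpr ⟨⟨fun _ => false, by simp⟩, ?_⟩
    rintro ⟨q, hq, hn⟩
    have h : q none = false := by simpa using fun h => hP (hn h)
    refine Subtype.ext (funext fun a => ?_)
    cases a with
    | none => exact h
    | some j => exact (hq j).resolve_left (by simp [h])

namespace CNF

variable {n : ℕ}

/-- The variables of the reduction: the original ones and, for every clause, a block consisting of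
a control variable `none` and of `n` padding variables. -/
abbrev BlockVar (φ : CNF n) : Type := Fin n ⊕ Fin φ.length × Option (Fin n)

/-- The clauses of the reduction: in the block of the clause `c`, the control variable implies the
negation of each literal of `c`, and each padding variable implies the control variable. -/
noncomputable def blockCNF (φ : CNF n) {N : ℕ} (e : BlockVar φ ≃ Fin N) : CNF N :=
  (List.finRange φ.length).flatMap fun i =>
    ((List.finRange n).map fun j =>
      {(e (.inr (i, none)), true), (e (.inr (i, some j)), false)}) ++
    ((φ.get i).toList.map fun l =>
      {(e (.inr (i, none)), false), (e (.inl l.1), !l.2)})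

variable (φ : CNF n) {N : ℕ} (e : BlockVar φ ≃ Fin N)

theorem mem_blockCNF {c : Finset (Fin N × Bool)} :
    c ∈ blockCNF φ e ↔ ∃ i,
      (∃ j, {(e (.inr (i, none)), true), (e (.inr (i, some j)), false)} = c) ∨
      ∃ l ∈ φ.get i, {(e (.inr (i, none)), false), (e (.inl l.1), !l.2)} = c := by
  simp only [blockCNF, List.mem_flatMap, List.mem_append, List.mem_map, List.mem_finRange,
    Finset.mem_toList, true_and]

theorem isKCNF_two_blockCNF : IsKCNF 2 (blockCNF φ e) := by
  intro c hc
  obtain ⟨i, ⟨j, rfl⟩ | ⟨l, -, rfl⟩⟩ := (mem_blockCNF φ e).mp hc <;> exact Finset.card_le_two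

theorem colorable_two_blockCNF : (primalGraph (blockCNF φ e)).Colorable 2 := by
  let color : BlockVar φ → Bool := fun v => v.elim (fun _ => false) fun p => p.2.isNone
  have key : ∀ c ∈ blockCNF φ e, ∀ u v : Fin N, (∃ b, (u, b) ∈ c) → (∃ b, (v, b) ∈ c) → u ≠ v →
      color (e.symm u) ≠ color (e.symm v) := by
    rintro c hc u v ⟨b, hb⟩ ⟨b', hb'⟩ huv
    obtain ⟨i, ⟨j, rfl⟩ | ⟨l, -, rfl⟩⟩ := (mem_blockCNF φ e).mp hc <;>
    · simp only [Finset.mem_insert, Finset.mem_singleton, Prod.mk.injEq] at hb hb'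
      obtain ⟨rfl, -⟩ | ⟨rfl, -⟩ := hb <;> obtain ⟨rfl, -⟩ | ⟨rfl, -⟩ := hb' <;>
        simp_all [color]
  refine (SimpleGraph.Coloring.mk (fun v => color (e.symm v)) ?_).colorable
  intro u v huv
  obtain ⟨hne, ⟨c, hc, hu, hv⟩ | ⟨c, hc, hv, hu⟩⟩ := (SimpleGraph.fromRel_adj _ _ _).mp huv
  · exact key c hc u v hu hv hne
  · exact key c hc u v hu hv hne

theorem sat_blockCNF (x : Fin N → Bool) :
    Sat x (blockCNF φ e) ↔ ∀ i,
      (∀ j, x (e (.inr (i, none))) = true ∨ x (e (.inr (i, some j))) = false) ∧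
      (x (e (.inr (i, none))) = true → ¬ ∃ l ∈ φ.get i, x (e (.inl l.1)) = l.2) := by
  constructor
  · intro h i
    refine ⟨fun j => ?_, ?_⟩
    · simpa using h _ ((mem_blockCNF φ e).mpr ⟨i, .inl ⟨j, rfl⟩⟩)
    · rintro hy ⟨l, hl, hx⟩
      simpa [hy, hx] using h _ ((mem_blockCNF φ e).mpr ⟨i, .inr ⟨l, hl, rfl⟩⟩)
  · intro h c hc
    obtain ⟨i, ⟨j, rfl⟩ | ⟨l, hl, rfl⟩⟩ := (mem_blockCNF φ e).mp hc
    · simpa using (h i).1 j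
    · cases hy : x (e (.inr (i, none)))
      · simp [hy]
      · have hx : x (e (.inl l.1)) = !l.2 :=
          Bool.eq_not.mpr fun hx => (h i).2 hy ⟨l, hl, hx⟩
        simp [hx]

open Classical in
theorem count_blockCNF :
    count (blockCNF φ e) = ∑ x : Fin n → Bool, ∏ i : Fin φ.length,
      if ¬ ∃ l ∈ φ.get i, x l.1 = l.2 then 2 ^ n + 1 else 1 := by
  let Q (x : Fin n → Bool) (i : Fin φ.length) (q : Option (Fin n) → Bool) : Prop :=
    (∀ j, q none = true ∨ q (some j) = false) ∧
      (q none = true → ¬ ∃ l ∈ φ.get i, x l.1 = l.2)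
  have hext : ∀ s t : Σ x : Fin n → Bool, ∀ i, {q : Option (Fin n) → Bool // Q x i q},
      s.1 = t.1 → (∀ i, (s.2 i).1 = (t.2 i).1) → s = t := by
    rintro ⟨x, s⟩ ⟨_, t⟩ rfl h
    exact congrArg (Sigma.mk x) (funext fun i => Subtype.ext (h i))
  let E : {x : Fin N → Bool // Sat x (blockCNF φ e)} ≃
      Σ x : Fin n → Bool, ∀ i, {q : Option (Fin n) → Bool // Q x i q} :=
    { toFun := fun y => ⟨fun a => y.1 (e (.inl a)), fun i =>
        ⟨fun o => y.1 (e (.inr (i, o))), (sat_blockCNF φ e y.1).mp y.2 i⟩⟩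
      invFun := fun s => ⟨fun v => (e.symm v).elim s.1 fun p => (s.2 p.1).1 p.2,
        (sat_blockCNF φ e _).mpr fun i => by simpa [Q] using (s.2 i).2⟩
      left_inv := by
        rintro ⟨y, hy⟩
        refine Subtype.ext (funext fun v => ?_)
        obtain ⟨a | p, rfl⟩ := e.surjective v <;> simp
      right_inv := by
        rintro ⟨x, q⟩
        exact hext _ _ (by simp) (by simp) }
  rw [count, Nat.card_congr E, Nat.card_sigma]
  refine Finset.sum_congr rfl fun x _ => ?_
  rw [Nat.card_pi]
  refine Finset.prod_congr rfl fun i _ => ?_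
  simpa only [Fintype.card_fin] using
    card_controlled_block (α := Fin n) (¬ ∃ l ∈ φ.get i, x l.1 = l.2)

open Classical in
theorem count_blockCNF_modEq : count (blockCNF φ e) ≡ count φ [MOD 2 ^ n + 1] := by
  have hφ : count φ = ∑ x : Fin n → Bool, if Sat x φ then 1 else 0 := by
    rw [count, Nat.card_eq_fintype_card, Fintype.card_subtype, Finset.card_filter]
  rw [count_blockCNF, hφ]
  refine Nat.ModEq.sum fun x _ => ?_
  split_ifs with hx
  · rw [Finset.prod_eq_one fun i _ => if_neg (not_not.mpr (hx _ (List.get_mem φ i)))]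
  · simp only [Sat, not_forall] at hx
    obtain ⟨c, hc, hcx⟩ := hx
    obtain ⟨i, rfl⟩ := List.get_of_mem hc
    refine Nat.modEq_zero_iff_dvd.mpr
      (dvd_trans ?_ (Finset.dvd_prod_of_mem _ (Finset.mem_univ i)))
    rw [if_pos hcx]

theorem count_le_two_pow : count φ ≤ 2 ^ n := by
  classical
  rw [count, Nat.card_eq_fintype_card]
  exact (Fintype.card_subtype_le _).trans (by simp)

end CNF

/-- counting reduction #SAT → #BI-2SAT (bipartite primal graph). -/
theorem sat_to_bipartite_twoSat :
    ∃ C : ℕ, ∀ (n m : ℕ) (φ : CNF n), φ.length = m →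
      ∃ (n' : ℕ) (φ' : CNF n'), n' ≤ C * (n + m * (n + 1)) ∧
        CNF.IsKCNF 2 φ' ∧ (CNF.primalGraph φ').Colorable 2 ∧
        CNF.count φ = CNF.count φ' % (2 ^ n + 1) := by
  refine ⟨1, ?_⟩
  rintro n m φ rfl
  let e : CNF.BlockVar φ ≃ Fin (n + φ.length * (n + 1)) :=
    Fintype.equivFinOfCardEq (by simp)
  refine ⟨_, CNF.blockCNF φ e, (one_mul _).ge, CNF.isKCNF_two_blockCNF φ e,
    CNF.colorable_two_blockCNF φ e, ?_⟩
  rw [CNF.count_blockCNF_modEq φ e, Nat.mod_eq_of_lt]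
  exact Nat.lt_succ_of_le (CNF.count_le_two_pow φ)
end

section
/- There exists a constant C : ℕ such that for every r : ℕ, every k ≥ 2, and every k-CNF formula φ over n variables with m clauses, there exists a monotone k-CNF formula φ' over at most C·(n + n·m·(r+1)) variables with at most C·(m + n·m·(r+1)) clauses such that #φ ≡ #φ' (mod 2^r). -/
namespace CNF

/-- Variables of the monotone formula: one for each literal, and `r` padding variables for each
original variable. -/
abbrev MonoVar (n r : ℕ) := (Fin n × Bool) ⊕ (Fin n × Fin r)

/-- Each literal becomes a variable of its own. For each `i`, at least one of the variables
`(i, true)` and `(i, false)` is true, and the padding variables of `i` are forced unless both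
are. -/
noncomputable def toMonotone {n : ℕ} (r : ℕ) {N : ℕ} (e : MonoVar n r ≃ Fin N) (φ : CNF n) :
    CNF N :=
  φ.map (fun c => c.image fun l => (e (.inl l), true)) ++
  ((Finset.univ : Finset (Fin n)).toList.map fun i =>
    {(e (.inl (i, true)), true), (e (.inl (i, false)), true)}) ++
  ((Finset.univ : Finset ((Fin n × Fin r) × Bool)).toList.map fun t =>
    {(e (.inl (t.1.1, t.2)), true), (e (.inr t.1), true)})

/-- The truth values `p` of the literals satisfy every clause, and for each variable one of its
two literals is true. -/
def LitSat {n : ℕ} (p : Fin n × Bool → Bool) (φ : CNF n) : Prop :=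
  (∀ c ∈ φ, ∃ l ∈ c, p l = true) ∧ ∀ i, p (i, true) = true ∨ p (i, false) = true

/-- The padding variables `y` are compatible with the truth values `p` of the literals. -/
def PadSat {n r : ℕ} (p : Fin n × Bool → Bool) (y : Fin n × Fin r → Bool) : Prop :=
  ∀ t : Fin n × Fin r, ∀ b, p (t.1, b) = true ∨ y t = true

theorem sat_toMonotone {n r N : ℕ} (e : MonoVar n r ≃ Fin N) (φ : CNF n) (z : Fin N → Bool) :
    Sat z (toMonotone r e φ) ↔
      LitSat (fun l => z (e (.inl l))) φ ∧ PadSat (fun l => z (e (.inl l))) fun t =>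
        z (e (.inr t)) := by
  simp only [Sat, toMonotone, List.mem_append, or_imp, forall_and, List.forall_mem_map,
    LitSat, PadSat, Finset.mem_toList, Finset.mem_univ, true_imp_iff, Finset.exists_mem_image,
    Finset.exists_mem_insert, Finset.mem_singleton, exists_eq_left, Prod.forall]

theorem card_padSat {n r : ℕ} (p : Fin n × Bool → Bool) :
    Nat.card {y : Fin n × Fin r → Bool // PadSat p y} =
      ∏ i, (if ∀ b, p (i, b) = true then 2 else 1) ^ r := by
  classical
  have h : ∀ y : Fin n × Fin r → Bool, PadSat p y ↔ y ∈ Fintype.piFinset fun t : Fin n × Fin r =>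
      (Finset.univ : Finset Bool).filter fun v => ∀ b, p (t.1, b) = true ∨ v = true := by
    intro y; simp [PadSat]
  rw [Nat.card_congr (Equiv.subtypeEquivRight h), Nat.card_eq_fintype_card, Fintype.card_coe,
    Fintype.card_piFinset, Fintype.prod_prod_type]
  refine Finset.prod_congr rfl fun i _ => ?_
  change ∏ _j : Fin r, (Finset.univ.filter fun v : Bool => ∀ b, p (i, b) = true ∨ v = true).card = _
  rw [Finset.prod_const, Finset.card_univ, Fintype.card_fin]
  congr 1
  simp only [Bool.forall_bool]
  cases p (i, false) <;> cases p (i, true) <;> simp [Finset.filter_eq']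

theorem card_padSat_modEq {n r : ℕ} (p : Fin n × Bool → Bool) :
    Nat.card {y : Fin n × Fin r → Bool // PadSat p y} ≡
      (if ∃ i, ∀ b, p (i, b) = true then 0 else 1) [MOD 2 ^ r] := by
  rw [card_padSat]
  split_ifs with h
  · obtain ⟨i, hi⟩ := h
    refine (Nat.modEq_zero_iff_dvd).2 (Dvd.dvd.trans ?_ (Finset.dvd_prod_of_mem _
      (Finset.mem_univ i)))
    rw [if_pos hi]
  · push Not at h
    rw [Finset.prod_eq_one]
    intro i _
    rw [if_neg (by simpa only [not_forall] using h i), one_pow]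

theorem count_toMonotone {n r N : ℕ} (e : MonoVar n r ≃ Fin N) (φ : CNF n) :
    count (toMonotone r e φ) = ∑ p : Fin n × Bool → Bool,
      Nat.card {y : Fin n × Fin r → Bool // LitSat p φ ∧ PadSat p y} := by
  rw [← Nat.card_sigma, count]
  refine Nat.card_congr ((Equiv.subtypeEquiv
    ((Equiv.arrowCongr e.symm (Equiv.refl Bool)).trans (Equiv.sumArrowEquivProdArrow _ _ _))
    (q := fun a => LitSat a.1 φ ∧ PadSat a.1 a.2) fun z => ?_).trans
    (Equiv.subtypeProdEquivSigmaSubtype fun p y => LitSat p φ ∧ PadSat p y))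
  exact sat_toMonotone e φ z

theorem count_eq_card_litSat {n : ℕ} (φ : CNF n) :
    count φ = Nat.card {p : Fin n × Bool → Bool //
      LitSat p φ ∧ ¬ ∃ i, ∀ b, p (i, b) = true} := by
  refine Nat.card_congr
    { toFun := fun x => ⟨fun l => decide (x.1 l.1 = l.2), ⟨?_, ?_⟩, ?_⟩
      invFun := fun p => ⟨fun i => p.1 (i, true), ?_⟩
      left_inv := ?_
      right_inv := ?_ }
  · intro c hc
    simpa using x.2 c hc
  · intro i
    cases h : x.1 i <;> simp [h]
  · rintro ⟨i, hi⟩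
    have h1 := hi true
    have h2 := hi false
    simp_all
  · obtain ⟨p, ⟨h1, h2⟩, h3⟩ := p
    intro c hc
    obtain ⟨⟨i, b⟩, hl, hp⟩ := h1 c hc
    refine ⟨(i, b), hl, ?_⟩
    cases b
    · by_contra h
      exact h3 ⟨i, by simp_all⟩
    · exact hp
  · intro x
    ext i
    simp
  · rintro ⟨p, ⟨h1, h2⟩, h3⟩
    ext ⟨i, b⟩
    cases b
    · have := h2 i
      have h4 : ¬ ∀ b, p (i, b) = true := fun h => h3 ⟨i, h⟩
      rw [Bool.forall_bool] at h4
      cases h : p (i, true) <;> cases h' : p (i, false) <;> simp_all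
    · simp

theorem count_modEq_count_toMonotone {n r N : ℕ} (e : MonoVar n r ≃ Fin N) (φ : CNF n) :
    count φ ≡ count (toMonotone r e φ) [MOD 2 ^ r] := by
  classical
  rw [count_toMonotone, count_eq_card_litSat, Nat.card_eq_fintype_card, Fintype.card_subtype,
    Finset.card_filter]
  refine Nat.ModEq.sum fun p _ => ?_
  by_cases h : LitSat p φ
  · have := (card_padSat_modEq (r := r) p).symm
    simp only [h, true_and, ite_not]
    convert this
  · simp [h, Nat.ModEq.refl]

theorem length_toMonotone {n r N : ℕ} (e : MonoVar n r ≃ Fin N) (φ : CNF n) :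
    (toMonotone r e φ).length = φ.length + n + n * r * 2 := by
  simp [toMonotone, add_assoc]

theorem monotone'_toMonotone {n r N : ℕ} (e : MonoVar n r ≃ Fin N) (φ : CNF n) :
    Monotone' (toMonotone r e φ) := by
  intro c hc l hl
  simp only [toMonotone, List.mem_append, List.mem_map] at hc
  rcases hc with (⟨d, -, rfl⟩ | ⟨i, -, rfl⟩) | ⟨t, -, rfl⟩
  · obtain ⟨a, -, rfl⟩ := Finset.mem_image.1 hl
    rfl
  all_goals
    simp only [Finset.mem_insert, Finset.mem_singleton] at hl
    rcases hl with rfl | rfl <;> rfl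

theorem IsKCNF.toMonotone {n r N k : ℕ} (e : MonoVar n r ≃ Fin N) {φ : CNF n} (hk : 2 ≤ k)
    (hφ : IsKCNF k φ) : IsKCNF k (toMonotone r e φ) := by
  intro c hc
  simp only [CNF.toMonotone, List.mem_append, List.mem_map] at hc
  rcases hc with (⟨d, hd, rfl⟩ | ⟨i, -, rfl⟩) | ⟨t, -, rfl⟩
  · exact Finset.card_image_le.trans (hφ d hd)
  all_goals exact Finset.card_le_two.trans hk

end CNF

/-- reduction #kSAT → #MON-kSAT modulo 2^r (Lemma `sattomonosat`). -/
theorem sat_to_monotoneSat_mod_two_pow :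
    ∃ C : ℕ, ∀ (r k : ℕ), 2 ≤ k → ∀ (n m : ℕ) (φ : CNF n), φ.length = m →
      CNF.IsKCNF k φ →
      ∃ (n' : ℕ) (φ' : CNF n'), n' ≤ C * (n + n * m * (r + 1)) ∧
        φ'.length ≤ C * (m + n * m * (r + 1)) ∧
        CNF.IsKCNF k φ' ∧ CNF.Monotone' φ' ∧
        CNF.count φ ≡ CNF.count φ' [MOD 2 ^ r] := by
  refine ⟨2, fun r k hk n m φ hm hφ => ?_⟩
  rcases Nat.eq_zero_or_pos m with rfl | hpos
  · obtain rfl := List.length_eq_zero_iff.1 hm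
    exact ⟨n, [], by omega, by simp, hφ, by simp [CNF.Monotone'], rfl⟩
  have hle : n * (r + 1) ≤ n * m * (r + 1) :=
    Nat.mul_le_mul_right _ (Nat.le_mul_of_pos_right n hpos)
  refine ⟨_, CNF.toMonotone r (Fintype.equivFin (CNF.MonoVar n r)) φ, ?_, ?_, hφ.toMonotone _ hk,
    CNF.monotone'_toMonotone _ φ, CNF.count_modEq_count_toMonotone _ φ⟩
  · simp only [Fintype.card_sum, Fintype.card_prod, Fintype.card_fin, Fintype.card_bool]
    nlinarith
  · rw [CNF.length_toMonotone]
    nlinarith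
end

section
/- For every natural number M ≥ 1 there exists a natural number n with 0 < n ≤ M^2 such that M divides the n-th Fibonacci number fib n. -/
/-- If two consecutive Fibonacci numbers recur modulo `M` after a shift by `d`, then `M` divides
`fib d`. -/
theorem fib_cast_eq_zero_of_recurrence {M d : ℕ} (i : ℕ)
    (h₀ : (Nat.fib i : ZMod M) = Nat.fib (i + d))
    (h₁ : (Nat.fib (i + 1) : ZMod M) = Nat.fib (i + d + 1)) :
    (Nat.fib d : ZMod M) = 0 := by
  induction i with
  | zero => simpa using h₀.symm
  | succ i ih =>
    rw [Nat.add_right_comm i 1 d] at h₀ h₁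
    refine ih ?_ h₀
    rw [Nat.fib_add_two, Nat.fib_add_two, Nat.cast_add, Nat.cast_add, h₀] at h₁
    exact add_right_cancel h₁

/-- for every M ≥ 1 some Fibonacci number among the first M² is
divisible by M (Lemma `fibexists`). -/
theorem exists_fib_dvd (M : ℕ) (hM : 1 ≤ M) :
    ∃ n : ℕ, 0 < n ∧ n ≤ M ^ 2 ∧ M ∣ Nat.fib n := by
  have : NeZero M := ⟨by lia⟩
  obtain ⟨i, hi, j, hj, hne, hij⟩ := Finset.exists_ne_map_eq_of_card_lt_of_maps_to
    (s := Finset.range (M ^ 2 + 1)) (t := (Finset.univ : Finset (ZMod M × ZMod M)))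
    (f := fun k => ((Nat.fib k : ZMod M), (Nat.fib (k + 1) : ZMod M)))
    (by simp [ZMod.card, sq]) (fun _ _ => Finset.mem_univ _)
  wlog hlt : i < j generalizing i j
  · exact this j hj i hi hne.symm hij.symm (by lia)
  obtain ⟨d, rfl⟩ := Nat.exists_eq_add_of_lt hlt
  simp only [Prod.mk.injEq] at hij
  rw [Finset.mem_range] at hj
  refine ⟨d + 1, d.succ_pos, by lia, ?_⟩
  rw [← ZMod.natCast_eq_zero_iff]
  exact fib_cast_eq_zero_of_recurrence i hij.1 hij.2
end

section
/- Let M ≥ 2 and n ≥ 2 be natural numbers such that the Fibonacci number fib n is congruent to 0 modulo M. Then over the ring ZMod M, the matrix power (!![1, 1; 1, 0])^n equals (fib (n−1)) • (identity matrix), and the residue (fib (n−1) : ZMod M) is a unit (invertible). -/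
/-- The powers of the Fibonacci matrix `!![1, 1; 1, 0]` have Fibonacci numbers as entries. -/
theorem Matrix.fib_matrix_pow_succ {R : Type*} [CommSemiring R] (n : ℕ) :
    (!![1, 1; 1, 0] : Matrix (Fin 2) (Fin 2) R) ^ (n + 1)
      = !![(Nat.fib (n + 2) : R), (Nat.fib (n + 1) : R);
          (Nat.fib (n + 1) : R), (Nat.fib n : R)] := by
  induction n with
  | zero => simp
  | succ n ih =>
    rw [pow_succ, ih, Matrix.mul_fin_two]
    simp [Nat.fib_add_two, add_comm, add_left_comm]

/-- if `fib n ≡ 0 (mod M)` then `!![1,1;1,0] ^ n` is the scalar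
matrix `fib (n-1) • 1` over `ZMod M`, and `fib (n-1)` is invertible mod `M`
(Lemma `sattocubicsatident`). -/
theorem fib_matrix_pow_eq_smul_one (M n : ℕ) (hM : 2 ≤ M) (hn : 2 ≤ n)
    (h : M ∣ Nat.fib n) :
    (!![1, 1; 1, 0] : Matrix (Fin 2) (Fin 2) (ZMod M)) ^ n
        = (Nat.fib (n - 1) : ZMod M) • (1 : Matrix (Fin 2) (Fin 2) (ZMod M)) ∧
      IsUnit ((Nat.fib (n - 1) : ZMod M)) := by
  obtain ⟨k, rfl⟩ : ∃ k, n = k + 1 := ⟨n - 1, by omega⟩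
  have h0 : (Nat.fib (k + 1) : ZMod M) = 0 := (ZMod.natCast_eq_zero_iff _ _).2 h
  refine ⟨?_, ?_⟩
  · rw [Matrix.fib_matrix_pow_succ, Nat.fib_add_two, Nat.cast_add, h0, Nat.add_sub_cancel,
      Matrix.one_fin_two, Matrix.smul_of]
    simp
  · rw [Nat.add_sub_cancel, ZMod.isUnit_iff_coprime]
    exact (Nat.fib_coprime_fib_succ k).coprime_dvd_right h
end

section
/- There exists a constant C : ℕ such that for every M ≥ 2 and k ≥ 2 with M dividing the Fibonacci number fib k, for every K ≥ 2 and every K-CNF formula φ over n variables with m clauses, there exists a K-CNF formula φ' over at most C·(n + m + n·m·(k+1)) variables with at most C·(n + m + n·m·(k+1)) clauses, in which every variable occurs in at most three clauses, and a unit c of the ring ZMod M such that (#φ : ZMod M) = c · (#φ' : ZMod M). -/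
theorem List.Nodup.countP_le_card {α : Type*} [DecidableEq α] {l : List α} (hl : l.Nodup)
    (p : α → Bool) (s : Finset α) (h : ∀ a ∈ l, p a = true → a ∈ s) : l.countP p ≤ s.card := by
  rw [List.countP_eq_length_filter, ← List.toFinset_card_of_nodup (hl.filter p)]
  refine Finset.card_le_card fun a ha => ?_
  simp only [List.mem_toFinset, List.mem_filter] at ha
  exact h a ha.1 ha.2

namespace CNF

variable {n m : ℕ}

/-- The `j`-th copy of the variable `i`. -/
def copyVar (j : Fin (m + 1)) (i : Fin n) : Fin (n * (m + 1)) := finProdFinEquiv (i, j)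

/-- The copy following `v` in the cyclic order on the copies of a variable. -/
def nextCopy (v : Fin (n * (m + 1))) : Fin (n * (m + 1)) :=
  copyVar ((finProdFinEquiv.symm v).2 + 1) (finProdFinEquiv.symm v).1

/-- The clause `v → nextCopy v`. -/
def nextClause (v : Fin (n * (m + 1))) : Finset (Fin (n * (m + 1)) × Bool) :=
  {(v, false), (nextCopy v, true)}

/-- The clause `c` with every variable replaced by its `j`-th copy. -/
def copyClause (j : Fin (m + 1)) (c : Finset (Fin n × Bool)) :
    Finset (Fin (n * (m + 1)) × Bool) :=
  c.image fun l => (copyVar j l.1, l.2)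

/-- Use the `j`-th copies of the variables in the `j`-th clause, and force all copies of a variable
to agree by a cycle of implications. -/
def splitVars (φ : CNF n) (h : φ.length = m + 1) : CNF (n * (m + 1)) :=
  (List.finRange (m + 1)).map (fun j => copyClause j (φ.get (j.cast h.symm))) ++
    (List.finRange (n * (m + 1))).map nextClause

theorem copyVar_inj {j j' : Fin (m + 1)} {i i' : Fin n} :
    copyVar j i = copyVar j' i' ↔ i = i' ∧ j = j' := by
  simp [copyVar]

theorem exists_copyVar (v : Fin (n * (m + 1))) : ∃ j i, v = copyVar j i :=
  ⟨(finProdFinEquiv.symm v).2, (finProdFinEquiv.symm v).1, (finProdFinEquiv.apply_symm_apply v).symm⟩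

theorem nextCopy_copyVar (j : Fin (m + 1)) (i : Fin n) :
    nextCopy (copyVar j i) = copyVar (j + 1) i := by
  simp [nextCopy, copyVar]

theorem nextCopy_injective : Function.Injective (nextCopy : Fin (n * (m + 1)) → _) := by
  intro v w h
  obtain ⟨j, i, rfl⟩ := exists_copyVar v
  obtain ⟨j', i', rfl⟩ := exists_copyVar w
  simpa [nextCopy_copyVar, copyVar_inj] using h

theorem length_splitVars (φ : CNF n) (h : φ.length = m + 1) :
    (splitVars φ h).length = (m + 1) + n * (m + 1) := by
  simp [splitVars]

theorem IsKCNF.splitVars {K : ℕ} (hK : 2 ≤ K) {φ : CNF n} (hφ : IsKCNF K φ)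
    (h : φ.length = m + 1) : IsKCNF K (splitVars φ h) := by
  intro c hc
  simp only [CNF.splitVars, List.mem_append, List.mem_map] at hc
  obtain ⟨j, -, rfl⟩ | ⟨v, -, rfl⟩ := hc
  · exact Finset.card_image_le.trans (hφ _ (List.get_mem _ _))
  · exact Finset.card_le_two.trans hK

theorem varDegree_splitVars_le (φ : CNF n) (h : φ.length = m + 1) (v : Fin (n * (m + 1))) :
    varDegree (splitVars φ h) v ≤ 3 := by
  obtain ⟨j, i, rfl⟩ := exists_copyVar v
  rw [varDegree, splitVars, List.countP_append, List.countP_map, List.countP_map]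
  refine (add_le_add (b := 1) (d := 2) ?_ ?_).trans le_rfl
  · refine ((List.nodup_finRange _).countP_le_card _ {j} fun j' _ hj' => ?_).trans_eq
      (Finset.card_singleton j)
    simp only [Function.comp_apply, decide_eq_true_eq, copyClause, Finset.mem_image,
      Prod.mk.injEq, copyVar_inj] at hj'
    obtain ⟨b, l, -, ⟨-, rfl⟩, -⟩ := hj'
    exact Finset.mem_singleton_self _
  · refine ((List.nodup_finRange _).countP_le_card _ {copyVar j i, copyVar (j - 1) i}
      fun w _ hw => ?_).trans Finset.card_le_two
    simp only [Function.comp_apply, decide_eq_true_eq, nextClause, Finset.mem_insert,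
      Finset.mem_singleton, Prod.mk.injEq] at hw ⊢
    obtain ⟨b, hw | hw⟩ := hw
    · exact Or.inl hw.1.symm
    · refine Or.inr (nextCopy_injective ?_)
      rw [nextCopy_copyVar, sub_add_cancel, hw.1]

theorem sat_splitVars_iff {φ : CNF n} {h : φ.length = m + 1} {y : Fin (n * (m + 1)) → Bool} :
    Sat y (splitVars φ h) ↔
      (∀ j : Fin (m + 1), ∃ l ∈ φ.get (j.cast h.symm), y (copyVar j l.1) = l.2) ∧
        ∀ j i, y (copyVar j i) = true → y (copyVar (j + 1) i) = true := by
  have key : ∀ v, (∃ l ∈ nextClause v, y l.1 = l.2) ↔ (y v = true → y (nextCopy v) = true) := by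
    intro v
    simp only [nextClause, Finset.mem_insert, Finset.mem_singleton, exists_eq_or_imp,
      exists_eq_left]
    cases y v <;> simp
  simp only [Sat, splitVars, List.mem_append, List.mem_map, List.mem_finRange, true_and, or_imp,
    forall_and, forall_exists_index, forall_apply_eq_imp_iff, key]
  refine and_congr ?_ ?_
  · simp only [copyClause, Finset.exists_mem_image]
  · refine ⟨fun H j i => by simpa only [nextCopy_copyVar] using H (copyVar j i), fun H v => ?_⟩
    obtain ⟨j, i, rfl⟩ := exists_copyVar v
    simpa only [nextCopy_copyVar] using H j i

open scoped Fin.NatCast in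
theorem eq_of_forall_imp_add_one {f : Fin (m + 1) → Bool}
    (hf : ∀ j, f j = true → f (j + 1) = true) (j j' : Fin (m + 1)) : f j = f j' := by
  have step : ∀ (a : ℕ) (j : Fin (m + 1)), f j = true → f (j + (a : Fin (m + 1))) = true := by
    intro a
    induction a with
    | zero => intro j hj; simpa using hj
    | succ a ih => intro j hj; simpa [add_assoc] using hf _ (ih j hj)
  have imp : ∀ j j', f j = true → f j' = true := by
    intro j j' hj
    simpa using step (j' - j).val j hj
  exact Bool.eq_iff_iff.2 ⟨imp j j', imp j' j⟩

theorem sat_iff_get {φ : CNF n} (h : φ.length = m + 1) {x : Fin n → Bool} :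
    Sat x φ ↔ ∀ j : Fin (m + 1), ∃ l ∈ φ.get (j.cast h.symm), x l.1 = l.2 := by
  refine ⟨fun H j => H _ (List.get_mem _ _), fun H c hc => ?_⟩
  obtain ⟨j, rfl⟩ := List.get_of_mem hc
  exact H (j.cast h)

theorem count_splitVars (φ : CNF n) (h : φ.length = m + 1) :
    count (splitVars φ h) = count φ := by
  have agree : ∀ {y}, Sat y (splitVars φ h) → ∀ j i, y (copyVar j i) = y (copyVar 0 i) :=
    fun {y} hy j i => eq_of_forall_imp_add_one (f := fun j => y (copyVar j i))
      (fun j => (sat_splitVars_iff.1 hy).2 j i) j 0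
  refine Nat.card_congr
    { toFun := fun y => ⟨fun i => y.1 (copyVar 0 i), (sat_iff_get h).2 fun j => ?_⟩
      invFun := fun x => ⟨fun v => x.1 (finProdFinEquiv.symm v).1,
        sat_splitVars_iff.2 ⟨fun j => ?_, fun j i => ?_⟩⟩
      left_inv := fun y => Subtype.ext (funext fun v => ?_)
      right_inv := fun x => Subtype.ext (funext fun i => ?_) }
  · simpa only [agree y.2] using (sat_splitVars_iff.1 y.2).1 j
  · simpa only [copyVar, Equiv.symm_apply_apply] using (sat_iff_get h).1 x.2 j
  · simp only [copyVar, Equiv.symm_apply_apply, imp_self]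
  · obtain ⟨j, i, rfl⟩ := exists_copyVar v
    have := agree y.2 j i
    simp only [copyVar, Equiv.symm_apply_apply] at this ⊢
    exact this.symm
  · simp only [copyVar, Equiv.symm_apply_apply]

end CNF

/-- reduction to degree at most three, modulo M with M ∣ fib k
(Lemma `sattocubicsatlemma`). -/
theorem sat_to_threeDeg_mod :
    ∃ C : ℕ, ∀ (M k : ℕ), 2 ≤ M → 2 ≤ k → M ∣ Nat.fib k →
      ∀ (K : ℕ), 2 ≤ K → ∀ (n m : ℕ) (φ : CNF n), φ.length = m →
      CNF.IsKCNF K φ →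
      ∃ (n' : ℕ) (φ' : CNF n'), n' ≤ C * (n + m + n * m * (k + 1)) ∧
        φ'.length ≤ C * (n + m + n * m * (k + 1)) ∧
        CNF.IsKCNF K φ' ∧ (∀ i, CNF.varDegree φ' i ≤ 3) ∧
        ∃ c : (ZMod M)ˣ,
          (CNF.count φ : ZMod M) = (c : ZMod M) * (CNF.count φ' : ZMod M) := by
  refine ⟨1, fun M k _ _ _ K hK n m φ hm hφ => ?_⟩
  obtain _ | m := m
  · obtain rfl := List.eq_nil_of_length_eq_zero hm
    exact ⟨n, [], by simp, by simp, hφ, fun i => by simp [CNF.varDegree], 1, by simp⟩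
  · have hle : n * (m + 1) ≤ n * (m + 1) * (k + 1) := Nat.le_mul_of_pos_right _ k.succ_pos
    refine ⟨n * (m + 1), CNF.splitVars φ hm, by lia, ?_, hφ.splitVars hK hm,
      CNF.varDegree_splitVars_le φ hm, 1, by simp [CNF.count_splitVars]⟩
    rw [CNF.length_splitVars]
    lia
end

section
/- There exists a constant C : ℕ such that for every r : ℕ and every 2-CNF formula φ over n variables with m clauses, there exists a 2-CNF formula φ' over at most C·(n + n·m·(r+1)) variables with at most C·(m + n·m·(r+1)) clauses whose primal graph is bipartite, such that #φ ≡ #φ' (mod 2^r + 1); moreover, if φ is monotone then φ' can be taken to be monotone. -/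
/-- Truth value of a literal. -/
def litVal {V : Type*} (x : V → Bool) (l : V × Bool) : Bool := x l.1 == l.2

/-- A finite family of binary clauses, each joining the two classes of a bipartition of the
variables, is realised by a bipartite 2-CNF. -/
theorem exists_bipartite_twoCNF {V K : Type*} [Fintype V] [Fintype K]
    (a b : K → V × Bool) (color : V → Bool) (hcolor : ∀ k, color (a k).1 ≠ color (b k).1) :
    ∃ ψ : CNF (Fintype.card V), ψ.length = Fintype.card K ∧ CNF.IsKCNF 2 ψ ∧
      (CNF.primalGraph ψ).Colorable 2 ∧
      CNF.count ψ = Nat.card {x : V → Bool // ∀ k, litVal x (a k) || litVal x (b k)} ∧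
      ((∀ k, (a k).2 = true ∧ (b k).2 = true) → CNF.Monotone' ψ) := by
  classical
  let e := Fintype.equivFin V
  let cl : K → Finset (Fin (Fintype.card V) × Bool) :=
    fun k => {(e (a k).1, (a k).2), (e (b k).1, (b k).2)}
  have hmem : ∀ c, c ∈ (Finset.univ : Finset K).toList.map cl ↔ ∃ k, cl k = c := by
    simp
  refine ⟨(Finset.univ : Finset K).toList.map cl, by simp, ?_, ?_, ?_, ?_⟩
  · intro c hc
    obtain ⟨k, rfl⟩ := (hmem c).1 hc
    exact Finset.card_le_two
  · have hrel : ∀ i j, i ≠ j → (∃ c ∈ (Finset.univ : Finset K).toList.map cl,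
        (∃ b, (i, b) ∈ c) ∧ (∃ b, (j, b) ∈ c)) → color (e.symm i) ≠ color (e.symm j) := by
      rintro i j hij ⟨c, hc, ⟨s, hs⟩, ⟨t, ht⟩⟩
      obtain ⟨k, rfl⟩ := (hmem c).1 hc
      have hk := hcolor k
      simp only [cl, Finset.mem_insert, Finset.mem_singleton, Prod.mk.injEq] at hs ht
      rcases hs with ⟨rfl, -⟩ | ⟨rfl, -⟩ <;> rcases ht with ⟨rfl, -⟩ | ⟨rfl, -⟩
      · exact absurd rfl hij
      · simpa using hk
      · simpa using hk.symm
      · exact absurd rfl hij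
    let C : (CNF.primalGraph ((Finset.univ : Finset K).toList.map cl)).Coloring Bool :=
      SimpleGraph.Coloring.mk (fun i => color (e.symm i)) (by
        intro i j hij
        rcases hij with ⟨hne, h | h⟩
        · exact hrel i j hne h
        · exact (hrel j i hne.symm h).symm)
    simpa using C.colorable
  · refine Nat.card_congr ((Equiv.arrowCongr e.symm (Equiv.refl Bool)).subtypeEquiv ?_)
    intro x
    simp only [CNF.Sat, hmem, forall_exists_index, forall_apply_eq_imp_iff]
    refine forall_congr' fun k => ?_
    simp [cl, litVal]
  · intro h c hc l hl
    obtain ⟨k, rfl⟩ := (hmem c).1 hc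
    simp only [cl, Finset.mem_insert, Finset.mem_singleton] at hl
    rcases hl with rfl | rfl
    · exact (h k).1
    · exact (h k).2

/-- Variables of the clause gadget: three core variables and `r` blocks of five leaves. -/
abbrev GadgetVar (r : ℕ) := Fin 3 ⊕ Fin r × Fin 5

/-- Clauses of the clause gadget. -/
abbrev GadgetClause (r : ℕ) := Fin 4 ⊕ Fin r × Fin 5

/-- The constraints on the core variables, given the truth values of the two literals. -/
def coreSat (u v : Bool) (p : Fin 3 → Bool) : Prop :=
  (u || p 1) ∧ (p 0 || p 1) ∧ (p 0 || p 2) ∧ (v || p 2)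

instance (u v : Bool) (p : Fin 3 → Bool) : Decidable (coreSat u v p) := by
  unfold coreSat; infer_instance

/-- The constraints on one block of leaves. -/
def leafSat (u v : Bool) (p : Fin 3 → Bool) (q : Fin 5 → Bool) : Prop :=
  (p 0 || q 0) ∧ (q 1 || p 2) ∧ (u || q 2) ∧ (u || q 3) ∧ (v || q 3)

instance (u v : Bool) (p : Fin 3 → Bool) (q : Fin 5 → Bool) : Decidable (leafSat u v p q) := by
  unfold leafSat; infer_instance

/-- The number of free leaves in a block. -/
def leafExp (u v : Bool) (p : Fin 3 → Bool) : ℕ :=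
  (p 0).toNat + (p 2).toNat + u.toNat + (u && v).toNat + 1

theorem card_leafSat : ∀ (u v : Bool) (p : Fin 3 → Bool),
    Fintype.card {q : Fin 5 → Bool // leafSat u v p q} = 2 ^ leafExp u v p := by
  decide +kernel

theorem sum_neg_one_pow_leafExp : ∀ u v : Bool,
    ∑ p : {p : Fin 3 → Bool // coreSat u v p}, (-1 : ℤ) ^ leafExp u v p.1 =
      if (u || v) then 1 else 0 := by
  decide +kernel

/-- Satisfying assignments of a gadget. -/
abbrev GadgetSol (r : ℕ) (u v : Bool) :=
  Σ p : {p : Fin 3 → Bool // coreSat u v p}, Fin r → {q : Fin 5 → Bool // leafSat u v p.1 q}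

theorem two_pow_eq_neg_one (r : ℕ) : (2 : ZMod (2 ^ r + 1)) ^ r = -1 := by
  have h := ZMod.natCast_self (2 ^ r + 1)
  push_cast at h
  exact eq_neg_of_add_eq_zero_left h

theorem card_gadgetSol (r : ℕ) (u v : Bool) :
    (Nat.card (GadgetSol r u v) : ZMod (2 ^ r + 1)) = if (u || v) then 1 else 0 := by
  have h := congrArg (Int.cast : ℤ → ZMod (2 ^ r + 1)) (sum_neg_one_pow_leafExp u v)
  push_cast at h
  rw [← h, Nat.card_eq_fintype_card, Fintype.card_sigma, Nat.cast_sum]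
  refine Finset.sum_congr rfl fun p _ => ?_
  rw [Fintype.card_fun, card_leafSat, Fintype.card_fin]
  push_cast
  rw [← pow_mul, mul_comm, pow_mul, two_pow_eq_neg_one]

section Gadget

variable {n m r : ℕ}

/-- Variables of the bipartite formula: the original ones and one gadget per clause. -/
abbrev BipVar (n m r : ℕ) := Fin n ⊕ Fin m × GadgetVar r

/-- First literal of each clause of the bipartite formula; `0` is the core variable shared by the
two halves of the gadget. -/
def bipFst (l₁ l₂ : Fin m → Fin n × Bool) : Fin m × GadgetClause r → BipVar n m r × Bool
  | (j, .inl k) => ![(.inl (l₁ j).1, (l₁ j).2), (.inr (j, .inl 0), true),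
      (.inr (j, .inl 0), true), (.inl (l₂ j).1, (l₂ j).2)] k
  | (j, .inr (i, k)) => ![(.inr (j, .inl 0), true), (.inr (j, .inr (i, 1)), true),
      (.inl (l₁ j).1, (l₁ j).2), (.inl (l₁ j).1, (l₁ j).2), (.inl (l₂ j).1, (l₂ j).2)] k

/-- Second literal of each clause of the bipartite formula. -/
def bipSnd : Fin m × GadgetClause r → BipVar n m r × Bool
  | (j, .inl k) => (.inr (j, .inl (![1, 1, 2, 2] k)), true)
  | (j, .inr (i, k)) => (.inr (j, ![.inr (i, 0), .inl 2, .inr (i, 2), .inr (i, 3),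
      .inr (i, 3)] k), true)

/-- The bipartition of the variables. -/
def bipColor : BipVar n m r → Bool
  | .inl _ => false
  | .inr (_, .inl k) => ![false, true, true] k
  | .inr (_, .inr (_, k)) => ![true, false, true, true, true] k

theorem bipColor_ne (l₁ l₂ : Fin m → Fin n × Bool) (k : Fin m × GadgetClause r) :
    bipColor (bipFst l₁ l₂ k).1 ≠ bipColor (bipSnd k : BipVar n m r × Bool).1 := by
  obtain ⟨j, k | ⟨i, k⟩⟩ := k <;> fin_cases k <;> simp [bipFst, bipSnd, bipColor]

theorem bip_monotone (l₁ l₂ : Fin m → Fin n × Bool) (h₁ : ∀ j, (l₁ j).2 = true)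
    (h₂ : ∀ j, (l₂ j).2 = true) (k : Fin m × GadgetClause r) :
    (bipFst l₁ l₂ k).2 = true ∧ (bipSnd k : BipVar n m r × Bool).2 = true := by
  obtain ⟨j, k | ⟨i, k⟩⟩ := k <;> fin_cases k <;> simp [bipFst, bipSnd, h₁, h₂]

theorem bip_sat_iff (l₁ l₂ : Fin m → Fin n × Bool) (x : BipVar n m r → Bool) :
    (∀ k, litVal x (bipFst l₁ l₂ k) || litVal x (bipSnd k)) ↔
      ∀ j, coreSat (litVal (fun i => x (.inl i)) (l₁ j)) (litVal (fun i => x (.inl i)) (l₂ j))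
          (fun k => x (.inr (j, .inl k))) ∧
        ∀ i, leafSat (litVal (fun i => x (.inl i)) (l₁ j)) (litVal (fun i => x (.inl i)) (l₂ j))
          (fun k => x (.inr (j, .inl k))) (fun k => x (.inr (j, .inr (i, k)))) := by
  simp only [Prod.forall, Sum.forall, Fin.forall_fin_succ, coreSat, leafSat, bipFst, bipSnd,
    litVal]
  simp

/-- The assignment assembled from the original variables and a solution of each gadget. -/
def gluedAssignment (l₁ l₂ : Fin m → Fin n × Bool)
    (s : Σ x : Fin n → Bool, ∀ j, GadgetSol r (litVal x (l₁ j)) (litVal x (l₂ j))) :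
    BipVar n m r → Bool
  | .inl i => s.1 i
  | .inr (j, .inl k) => (s.2 j).1.1 k
  | .inr (j, .inr (i, k)) => ((s.2 j).2 i).1 k

/-- Satisfying assignments of the bipartite formula, grouped by the original variables. -/
def bipSolEquiv (l₁ l₂ : Fin m → Fin n × Bool) :
    {x : BipVar n m r → Bool // ∀ k, litVal x (bipFst l₁ l₂ k) || litVal x (bipSnd k)} ≃
      Σ x : Fin n → Bool, ∀ j, GadgetSol r (litVal x (l₁ j)) (litVal x (l₂ j)) where
  toFun x := ⟨fun i => x.1 (.inl i), fun j =>
    ⟨⟨fun k => x.1 (.inr (j, .inl k)), ((bip_sat_iff l₁ l₂ x.1).1 x.2 j).1⟩,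
      fun i => ⟨fun k => x.1 (.inr (j, .inr (i, k))), ((bip_sat_iff l₁ l₂ x.1).1 x.2 j).2 i⟩⟩⟩
  invFun s := ⟨gluedAssignment l₁ l₂ s,
    (bip_sat_iff l₁ l₂ (gluedAssignment l₁ l₂ s)).2 fun j =>
      ⟨(s.2 j).1.2, fun i => ((s.2 j).2 i).2⟩⟩
  left_inv x := by
    apply Subtype.ext
    funext v
    obtain i | ⟨j, k | ⟨i, k⟩⟩ := v <;> rfl
  right_inv s := rfl

theorem card_bipSol (l₁ l₂ : Fin m → Fin n × Bool) :
    (Nat.card {x : BipVar n m r → Bool //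
        ∀ k, litVal x (bipFst l₁ l₂ k) || litVal x (bipSnd k)} : ZMod (2 ^ r + 1)) =
      Nat.card {x : Fin n → Bool // ∀ j, litVal x (l₁ j) || litVal x (l₂ j)} := by
  rw [Nat.card_congr (bipSolEquiv l₁ l₂), Nat.card_sigma, Nat.cast_sum,
    Nat.card_eq_fintype_card, Fintype.card_subtype, Finset.natCast_card_filter]
  refine Finset.sum_congr rfl fun x _ => ?_
  rw [Nat.card_pi, Nat.cast_prod, Finset.prod_congr rfl fun j _ => card_gadgetSol r _ _]
  simp [Finset.prod_boole]

end Gadget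

theorem Finset.exists_eq_pair_of_card_le_two {α : Type*} [DecidableEq α] {s : Finset α}
    (hs : s.card ≤ 2) (hne : s ≠ ∅) : ∃ a b, s = {a, b} := by
  have h0 := Finset.card_pos.2 (Finset.nonempty_iff_ne_empty.2 hne)
  obtain h | h : s.card = 1 ∨ s.card = 2 := by omega
  · obtain ⟨a, rfl⟩ := Finset.card_eq_one.1 h
    exact ⟨a, a, by simp⟩
  · obtain ⟨a, b, -, rfl⟩ := Finset.card_eq_two.1 h
    exact ⟨a, b, rfl⟩

/-- reduction #2SAT → #BI-2SAT modulo 2^r + 1, preserving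
monotonicity (Lemma `2sattobi2satlemma`). -/
theorem twoSat_to_bipartite_twoSat_mod :
    ∃ C : ℕ, ∀ (r : ℕ) (n m : ℕ) (φ : CNF n), φ.length = m →
      CNF.IsKCNF 2 φ →
      ∃ (n' : ℕ) (φ' : CNF n'), n' ≤ C * (n + n * m * (r + 1)) ∧
        φ'.length ≤ C * (m + n * m * (r + 1)) ∧
        CNF.IsKCNF 2 φ' ∧ (CNF.primalGraph φ').Colorable 2 ∧
        CNF.count φ ≡ CNF.count φ' [MOD 2 ^ r + 1] ∧
        (CNF.Monotone' φ → CNF.Monotone' φ') := by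
  classical
  refine ⟨5, fun r n m φ hm hφ => ?_⟩
  by_cases hempty : ∅ ∈ φ
  · have hpos : 0 < m := hm ▸ List.length_pos_of_mem hempty
    have hcount : ∀ {k : ℕ} {ψ : CNF k}, ∅ ∈ ψ → CNF.count ψ = 0 := by
      intro k ψ h
      have : IsEmpty {x : Fin k → Bool // CNF.Sat x ψ} :=
        ⟨fun x => by simpa using x.2 ∅ h⟩
      exact Nat.card_of_isEmpty
    refine ⟨0, [∅], Nat.zero_le _, ?_, ?_, ?_, ?_, ?_⟩
    · simp only [List.length_singleton]
      nlinarith [Nat.zero_le (n * m * (r + 1))]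
    · simp [CNF.IsKCNF]
    · exact ⟨SimpleGraph.Coloring.mk Fin.elim0 fun {v} => v.elim0⟩
    · rw [hcount hempty, hcount (by simp)]
    · simp [CNF.Monotone']
  · have hpair : ∀ j : Fin m, ∃ a b, φ.get (j.cast hm.symm) = {a, b} := fun j =>
      Finset.exists_eq_pair_of_card_le_two (hφ _ (List.get_mem _ _))
        fun h => hempty (h ▸ List.get_mem _ _)
    choose l₁ l₂ hl using hpair
    have hmem : ∀ c, c ∈ φ ↔ ∃ j, ({l₁ j, l₂ j} : Finset _) = c := by
      intro c
      subst hm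
      simp only [← hl, List.mem_iff_get]
      rfl
    obtain ⟨ψ, hlen, hk, hcol, hcount, hmono⟩ :=
      exists_bipartite_twoCNF (bipFst (r := r) l₁ l₂) bipSnd bipColor (bipColor_ne l₁ l₂)
    have hle : m ≤ n * m := by
      rcases Nat.eq_zero_or_pos m with rfl | h
      · simp
      · exact Nat.le_mul_of_pos_left m (l₁ ⟨0, h⟩).1.pos
    have hle' : m * (r + 1) ≤ n * m * (r + 1) := Nat.mul_le_mul_right _ hle
    refine ⟨_, ψ, ?_, ?_, hk, hcol, ?_, fun hφm => hmono (bip_monotone l₁ l₂ ?_ ?_)⟩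
    · simp only [Fintype.card_sum, Fintype.card_prod, Fintype.card_fin]
      nlinarith
    · rw [hlen]
      simp only [Fintype.card_sum, Fintype.card_prod, Fintype.card_fin]
      nlinarith
    · rw [← ZMod.natCast_eq_natCast_iff, hcount, card_bipSol, CNF.count]
      congr 1
      refine Nat.card_congr (Equiv.subtypeEquivRight fun x => ?_)
      simp only [CNF.Sat, hmem, forall_exists_index, forall_apply_eq_imp_iff]
      simp only [Finset.mem_insert, Finset.mem_singleton, exists_eq_or_imp, exists_eq_left,
        litVal, Bool.or_eq_true, beq_iff_eq]
    · exact fun j => hφm _ ((hmem _).2 ⟨j, rfl⟩) _ (by simp)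
    · exact fun j => hφm _ ((hmem _).2 ⟨j, rfl⟩) _ (by simp)
end

section
/- There exists a constant C : ℕ such that for every 2-CNF formula φ over n variables with m clauses, there exists an XSAT instance f over at most n + C·m variables such that #φ = #f. -/
/-- Renaming the variables of a clause along an embedding. -/
def renameClause {n N : ℕ} (ι : Fin n ↪ Fin N) (c : Finset (Fin n × Bool)) :
    Finset (Fin N × Bool) :=
  c.map (ι.prodMap (Function.Embedding.refl Bool))

theorem card_renameClause {n N : ℕ} (ι : Fin n ↪ Fin N) (c : Finset (Fin n × Bool)) :
    (renameClause ι c).card = c.card :=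
  Finset.card_map _

theorem exists_true_renameClause {n N : ℕ} (ι : Fin n ↪ Fin N) (c : Finset (Fin n × Bool))
    (x : Fin N → Bool) :
    (∃ l ∈ renameClause ι c, x l.1 = l.2) ↔ ∃ l ∈ c, (x ∘ ι) l.1 = l.2 := by
  constructor
  · rintro ⟨l, hl, h⟩
    obtain ⟨l', hl', rfl⟩ := Finset.mem_map.1 hl
    exact ⟨l', hl', h⟩
  · rintro ⟨l, hl, h⟩
    exact ⟨_, Finset.mem_map_of_mem _ hl, h⟩

theorem xSat_map_renameClause {n N : ℕ} (ι : Fin n ↪ Fin N) (f : CNF n) (x : Fin N → Bool) :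
    XSat x (f.map (renameClause ι)) ↔ XSat (x ∘ ι) f := by
  simp only [XSat, List.forall_mem_map, renameClause, Finset.filter_map, Finset.card_map]
  rfl

theorem xSat_append {n : ℕ} (f g : CNF n) (x : Fin n → Bool) :
    XSat x (f ++ g) ↔ XSat x f ∧ XSat x g :=
  List.forall_mem_append

/-- A clause with at most two literals is expressed by XSAT clauses using one additional
variable, whose value is a function of the others. -/
theorem exists_xsat_gadget {N : ℕ} (c : Finset (Fin N × Bool)) (hc : c.card ≤ 2) :
    ∃ (g : CNF (N + 1)) (s : (Fin N → Bool) → Bool), ∀ x : Fin (N + 1) → Bool,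
      XSat x g ↔ (∃ l ∈ c, (x ∘ Fin.castSucc) l.1 = l.2) ∧
        x (Fin.last N) = s (x ∘ Fin.castSucc) := by
  have h012 : c.card = 0 ∨ c.card = 1 ∨ c.card = 2 := by omega
  rcases h012 with h | h | h
  · obtain rfl := Finset.card_eq_zero.1 h
    exact ⟨[∅], fun _ => true, fun x => by simp [XSat]⟩
  · obtain ⟨⟨i, p⟩, rfl⟩ := Finset.card_eq_one.1 h
    refine ⟨[{(i.castSucc, p)}, {(Fin.last N, true)}], fun _ => true, fun x => ?_⟩
    simp only [XSat, List.forall_mem_cons, Finset.filter_singleton]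
    by_cases h₁ : x i.castSucc = p <;> by_cases h₂ : x (Fin.last N) = true <;> simp [h₁, h₂]
  · obtain ⟨⟨i, p⟩, ⟨j, q⟩, hne, rfl⟩ := Finset.card_eq_two.1 h
    refine ⟨[{(i.castSucc, !p), (j.castSucc, !q), (Fin.last N, true)}],
      fun y => (y i == p) && (y j == q), fun x => ?_⟩
    have hne' : (i.castSucc, !p) ≠ (j.castSucc, !q) := by
      simpa [Prod.ext_iff] using hne
    have hi := (Fin.castSucc_lt_last i).ne
    have hj := (Fin.castSucc_lt_last j).ne
    simp only [XSat, List.forall_mem_cons, Finset.filter_insert, Finset.filter_singleton]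
    generalize hxi : x i.castSucc = a
    generalize hxj : x j.castSucc = b
    generalize hxl : x (Fin.last N) = d
    cases p <;> cases q <;> cases a <;> cases b <;> cases d <;>
      simp_all [Finset.card_insert_of_notMem]

theorem exists_xsat_add_clause {N : ℕ} (f : CNF N) (c : Finset (Fin N × Bool))
    (hc : c.card ≤ 2) :
    ∃ f' : CNF (N + 1), Set.BijOn (fun x : Fin (N + 1) → Bool => x ∘ Fin.castSucc)
      {x | XSat x f'} {y | XSat y f ∧ ∃ l ∈ c, y l.1 = l.2} := by
  obtain ⟨g, s, hg⟩ := exists_xsat_gadget c hc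
  refine ⟨f.map (renameClause Fin.castSuccEmb) ++ g, ?_⟩
  have key : ∀ x : Fin (N + 1) → Bool,
      XSat x (f.map (renameClause Fin.castSuccEmb) ++ g) ↔
      XSat (x ∘ Fin.castSucc) f ∧ (∃ l ∈ c, (x ∘ Fin.castSucc) l.1 = l.2) ∧
        x (Fin.last N) = s (x ∘ Fin.castSucc) := fun x => by
    rw [xSat_append, xSat_map_renameClause, hg]
    rfl
  refine ⟨fun x hx => ?_, fun x hx y hy hxy => ?_, fun y hy => ?_⟩
  · obtain ⟨h₁, h₂, -⟩ := (key x).1 hx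
    exact ⟨h₁, h₂⟩
  · have hx' := ((key x).1 hx).2.2
    have hy' := ((key y).1 hy).2.2
    funext i
    refine Fin.lastCases ?_ (fun j => congrFun hxy j) i
    rw [hx', hy']
    exact congrArg s hxy
  · have hres : (Fin.snoc (α := fun _ => Bool) y (s y)) ∘ Fin.castSucc = y := by
      funext i
      simp
    refine ⟨Fin.snoc (α := fun _ => Bool) y (s y), (key _).2 ?_, hres⟩
    rw [hres]
    exact ⟨hy.1, hy.2, by simp⟩

theorem exists_xsat_bijOn {n : ℕ} (φ : CNF n) (hφ : CNF.IsKCNF 2 φ) :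
    ∃ (N : ℕ) (ι : Fin n ↪ Fin N) (f : CNF N), N = n + φ.length ∧
      Set.BijOn (fun x : Fin N → Bool => x ∘ ι) {x | XSat x f} {x | CNF.Sat x φ} := by
  induction φ with
  | nil =>
    exact ⟨n, Function.Embedding.refl _, [], rfl, fun _ _ => List.forall_mem_nil _,
      Set.injOn_id _, fun x _ => ⟨x, List.forall_mem_nil _, rfl⟩⟩
  | cons c φ ih =>
    obtain ⟨N, ι, f, hN, hf⟩ := ih fun d hd => hφ d (List.mem_cons_of_mem _ hd)
    obtain ⟨f', hf'⟩ := exists_xsat_add_clause f (renameClause ι c)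
      ((card_renameClause ι c).trans_le (hφ c List.mem_cons_self))
    refine ⟨N + 1, ι.trans Fin.castSuccEmb, f', by simp [hN, add_assoc], ?_⟩
    have hmid : Set.BijOn (fun x : Fin N → Bool => x ∘ ι)
        {y | XSat y f ∧ ∃ l ∈ renameClause ι c, y l.1 = l.2} {x | CNF.Sat x (c :: φ)} := by
      simp only [exists_true_renameClause]
      refine ⟨fun y hy => List.forall_mem_cons.2 ⟨hy.2, hf.mapsTo hy.1⟩,
        hf.injOn.mono fun y hy => hy.1, fun x hx => ?_⟩
      obtain ⟨hc, hx'⟩ := List.forall_mem_cons.1 hx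
      obtain ⟨y, hy, rfl⟩ := hf.surjOn hx'
      exact ⟨y, ⟨hy, hc⟩, rfl⟩
    exact hmid.comp hf'

/-- parsimonious reduction #2SAT → #XSAT (Lemma `xsat-sp-complete`,
first direction). -/
theorem twoSat_to_xsat :
    ∃ C : ℕ, ∀ (n m : ℕ) (φ : CNF n), φ.length = m → CNF.IsKCNF 2 φ →
      ∃ (n' : ℕ) (f : CNF n'), n' ≤ n + C * m ∧
        CNF.count φ = xcount f := by
  refine ⟨1, fun n m φ hm hφ => ?_⟩
  obtain ⟨N, ι, f, hN, hf⟩ := exists_xsat_bijOn φ hφ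
  exact ⟨N, f, by omega, (Nat.card_congr (Set.BijOn.equiv _ hf)).symm⟩
end
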